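/- For any weight sigma of K, the K-subrepresentation of ind_K^G sigma generated by f_1 is isomorphic, as a representation of K (equivalently of Gamma_K), to the principal series Ind_B^{Gamma_K} chi_sigma^s, where chi_sigma^s is viewed as a character of B via B ->> B/U ≅ H_0/H_1. -/

import Mathlib

open scoped Classical

noncomputable section

namespace U21

/-- The arithmetic setting: `E` is the unramified quadratic extension of a non-archimedean
local field `F` of odd residue characteristic `p`, with residue field of `F` of cardinality
`q = p ^ fdeg`.  The field `E` is encoded through its valuation subring `O = o_E`, a
uniformizer `ϖ`, the maximal ideal `mI` (so that `p_E^k` is `ϖ ^ k * O`), and the nontrivial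
`F`-automorphism `conj` of `E` (which induces the `q`-power Frobenius on the residue field
of `E`, of cardinality `q ^ 2`). -/
structure Setting where
  p : ℕ
  q : ℕ
  fdeg : ℕ
  hp : p.Prime
  hodd : p ≠ 2
  hfdeg : 0 < fdeg
  hq : q = p ^ fdeg
  E : Type
  [fieldE : Field E]
  conj : E →+* E
  conj_invol : ∀ x, conj (conj x) = x
  conj_ne : conj ≠ RingHom.id E
  O : Subring E
  val_ring : ∀ x : E, x ≠ 0 → x ∈ O ∨ x⁻¹ ∈ O
  conj_O : ∀ x, x ∈ O → conj x ∈ O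
  ϖ : E
  unif_mem : ϖ ∈ O
  unif_ne : ϖ ≠ 0
  unif_conj : conj ϖ = ϖ
  unif_not_unit : ¬ IsUnit (⟨ϖ, unif_mem⟩ : O)
  disc : ∀ x : E, x ≠ 0 → ∃ (n : ℤ) (u : Oˣ), x = (u : O) * ϖ ^ n
  mI : Ideal O
  hmI : ∀ x : O, x ∈ mI ↔ ∃ y ∈ O, (x : E) = ϖ * y
  [fin_res : Fintype (O ⧸ mI)]
  card_res : Fintype.card (O ⧸ mI) = q ^ 2
  res_frob : ∀ x : O, Ideal.Quotient.mk mI ⟨conj x, conj_O x x.2⟩ = (Ideal.Quotient.mk mI x) ^ q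
  complete : ∀ a : ℕ → E,
    (∀ k : ℕ, ∃ N, ∀ m ≥ N, ∀ n ≥ N, ∃ w ∈ O, a m - a n = ϖ ^ k * w) →
    ∃ L : E, ∀ k : ℕ, ∃ N, ∀ n ≥ N, ∃ w ∈ O, a n - L = ϖ ^ k * w

attribute [instance] Setting.fieldE Setting.fin_res

namespace Setting

variable (S : Setting)

/-- 3×3 matrices over `E`. -/
abbrev M3 := Matrix (Fin 3) (Fin 3) S.E

/-- The antidiagonal matrix `β` of the Hermitian form. -/
def betaM : S.M3 := !![0,0,1;0,1,0;1,0,0]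

/-- The fractional ideal `p_E ^ k ⊆ E` (for `k : ℤ`). -/
def pE (k : ℤ) : Set S.E := {z | ∃ w ∈ S.O, z = S.ϖ ^ k * w}

/-- The unramified unitary group `G = U(2,1)(E/F)`, as a subgroup of `GL₃(E)`:
`g ∈ G` iff `g.transpose * β * conj g = β`. -/
def Gsub : Subgroup (Matrix.GeneralLinearGroup (Fin 3) S.E) where
  carrier := {g | ((g : S.M3)).transpose * S.betaM * ((g : S.M3).map S.conj) = S.betaM}
  one_mem' := by
    simp [Matrix.map_one (⇑S.conj) (map_zero S.conj) (map_one S.conj)]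
  mul_mem' := by
    intro a b ha hb
    simp only [Set.mem_setOf_eq, Units.val_mul, Matrix.transpose_mul, Matrix.map_mul] at ha hb ⊢
    calc ((b : S.M3)).transpose * ((a : S.M3)).transpose * S.betaM * ((a : S.M3).map S.conj * (b : S.M3).map S.conj)
        = ((b : S.M3)).transpose * (((a : S.M3)).transpose * S.betaM * (a : S.M3).map S.conj) * ((b : S.M3).map S.conj) := by
          simp only [mul_assoc]
      _ = S.betaM := by rw [ha]; exact hb
  inv_mem' := by
    intro a ha
    simp only [Set.mem_setOf_eq] at ha ⊢
    have hA : IsUnit ((a : S.M3)) := a.isUnit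
    have hdet : IsUnit ((a : S.M3)).det := (Matrix.isUnit_iff_isUnit_det _).mp hA
    have hAc : IsUnit (((a : S.M3)).map ⇑S.conj) := by
      rw [← RingHom.mapMatrix_apply]; exact hA.map _
    have hdetc : IsUnit ((((a : S.M3)).map ⇑S.conj).det) := (Matrix.isUnit_iff_isUnit_det _).mp hAc
    have hdetT : IsUnit ((((a : S.M3)).transpose).det) := by rw [Matrix.det_transpose]; exact hdet
    have hmapinv : ((a : S.M3)⁻¹).map ⇑S.conj = (((a : S.M3)).map ⇑S.conj)⁻¹ := by
      symm
      apply Matrix.inv_eq_left_inv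
      rw [← Matrix.map_mul, Matrix.nonsing_inv_mul _ hdet,
        Matrix.map_one (⇑S.conj) (map_zero S.conj) (map_one S.conj)]
    rw [Matrix.coe_units_inv, Matrix.transpose_nonsing_inv, hmapinv]
    conv_lhs => rw [← ha]
    calc (((a:S.M3)).transpose)⁻¹ * (((a:S.M3)).transpose * S.betaM * ((a:S.M3)).map ⇑S.conj) * (((a:S.M3)).map ⇑S.conj)⁻¹
        = (((a:S.M3)).transpose)⁻¹ * ((a:S.M3)).transpose * S.betaM *
            (((a:S.M3)).map ⇑S.conj * (((a:S.M3)).map ⇑S.conj)⁻¹) := by simp only [mul_assoc]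
      _ = S.betaM := by
          rw [Matrix.nonsing_inv_mul _ hdetT, Matrix.mul_nonsing_inv _ hdetc, one_mul, mul_one]

/-- The group `G = U(2,1)(E/F)`. -/
abbrev GG := ↥S.Gsub

/-- The matrix of an element of `G`. -/
def mat (g : S.GG) : S.M3 := ((g : Matrix.GeneralLinearGroup (Fin 3) S.E) : S.M3)

/-- The upper unipotent matrix `n(x,y)`. -/
def nM (x y : S.E) : S.M3 := !![1, x, y; 0, 1, -S.conj x; 0, 0, 1]

/-- The lower unipotent matrix `n'(x,y)`. -/
def n'M (x y : S.E) : S.M3 := !![1, 0, 0; x, 1, 0; y, -S.conj x, 1]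

/-- The diagonal matrix `h(x) = diag(x, -x̄x⁻¹, x̄⁻¹)`. -/
def hM (x : S.E) : S.M3 := !![x, 0, 0; 0, -S.conj x * x⁻¹, 0; 0, 0, (S.conj x)⁻¹]

/-- The subgroup `N` of `G` (unipotent radical of the upper triangular Borel), as a set. -/
def Nset : Set S.GG := {g | ∃ x y : S.E, x * S.conj x + y + S.conj y = 0 ∧ S.mat g = S.nM x y}

/-- The subgroup `N_k = {n(x,y) : y ∈ p_E^k}`, as a set. -/
def Nk (k : ℤ) : Set S.GG :=
  {g | ∃ x y : S.E, x * S.conj x + y + S.conj y = 0 ∧ y ∈ S.pE k ∧ S.mat g = S.nM x y}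

/-- The subgroup `N'` of `G`, as a set. -/
def N'set : Set S.GG := {g | ∃ x y : S.E, x * S.conj x + y + S.conj y = 0 ∧ S.mat g = S.n'M x y}

/-- The subgroup `N'_k = {n'(x,y) : y ∈ p_E^k}`, as a set. -/
def N'k (k : ℤ) : Set S.GG :=
  {g | ∃ x y : S.E, x * S.conj x + y + S.conj y = 0 ∧ y ∈ S.pE k ∧ S.mat g = S.n'M x y}

/-- The diagonal subgroup `H` of `G`, as a set. -/
def Hset : Set S.GG := {g | ∃ a b c : S.E, S.mat g = !![a,0,0;0,b,0;0,0,c]}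

/-- The hyperspecial maximal compact subgroup `K₀ = G ∩ GL₃(o_E)`, as a set. -/
def K0set : Set S.GG := {g | ∀ i j, S.mat g i j ∈ S.O}

/-- The special (non-hyperspecial) maximal compact subgroup `K₁`, as a set. -/
def K1set : Set S.GG :=
  {g | S.mat g 0 0 ∈ S.O ∧ S.mat g 0 1 ∈ S.O ∧ S.mat g 0 2 ∈ S.pE (-1) ∧
       S.mat g 1 0 ∈ S.pE 1 ∧ S.mat g 1 1 ∈ S.O ∧ S.mat g 1 2 ∈ S.O ∧
       S.mat g 2 0 ∈ S.pE 1 ∧ S.mat g 2 1 ∈ S.pE 1 ∧ S.mat g 2 2 ∈ S.O}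

/-- The Iwahori subgroup `I_{K₀}` (preimage of the Borel of `Γ_{K₀}`), as a set. -/
def IK0 : Set S.GG :=
  {g | g ∈ S.K0set ∧ S.mat g 1 0 ∈ S.pE 1 ∧ S.mat g 2 0 ∈ S.pE 1 ∧ S.mat g 2 1 ∈ S.pE 1}

/-- The pro-p Iwahori subgroup `I_{1,K₀}`, as a set. -/
def I1K0 : Set S.GG :=
  {g | g ∈ S.IK0 ∧ S.mat g 0 0 - 1 ∈ S.pE 1 ∧ S.mat g 1 1 - 1 ∈ S.pE 1 ∧ S.mat g 2 2 - 1 ∈ S.pE 1}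

/-- The opposite pro-p Iwahori subgroup `I'_{1,K₀}`, as a set. -/
def I1'K0 : Set S.GG :=
  {g | g ∈ S.K0set ∧ S.mat g 0 1 ∈ S.pE 1 ∧ S.mat g 0 2 ∈ S.pE 1 ∧ S.mat g 1 2 ∈ S.pE 1 ∧
       S.mat g 0 0 - 1 ∈ S.pE 1 ∧ S.mat g 1 1 - 1 ∈ S.pE 1 ∧ S.mat g 2 2 - 1 ∈ S.pE 1}

/-- The maximal normal pro-p subgroup `K₀¹` of `K₀` (principal congruence subgroup), as a set. -/
def Kone0 : Set S.GG := {g | ∀ i j, S.mat g i j - (1 : S.M3) i j ∈ S.pE 1}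

/-- The Iwahori subgroup `I_{K₁}`, as a set. -/
def IK1 : Set S.GG := {g | g ∈ S.K1set ∧ S.mat g 2 0 ∈ S.pE 2}

/-- The pro-p Iwahori subgroup `I_{1,K₁}`, as a set. -/
def I1K1 : Set S.GG :=
  {g | g ∈ S.IK1 ∧ S.mat g 0 0 - 1 ∈ S.pE 1 ∧ S.mat g 1 1 - 1 ∈ S.pE 1 ∧ S.mat g 2 2 - 1 ∈ S.pE 1}

/-- The opposite pro-p Iwahori subgroup `I'_{1,K₁}`, as a set. -/
def I1'K1 : Set S.GG :=
  {g | g ∈ S.K1set ∧ S.mat g 0 2 ∈ S.O ∧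
       S.mat g 0 0 - 1 ∈ S.pE 1 ∧ S.mat g 1 1 - 1 ∈ S.pE 1 ∧ S.mat g 2 2 - 1 ∈ S.pE 1}

/-- The maximal normal pro-p subgroup `K₁¹` of `K₁`, as a set. -/
def Kone1 : Set S.GG :=
  {g | g ∈ S.K1set ∧ S.mat g 0 2 ∈ S.O ∧ S.mat g 2 0 ∈ S.pE 2 ∧
       S.mat g 0 0 - 1 ∈ S.pE 1 ∧ S.mat g 1 1 - 1 ∈ S.pE 1 ∧ S.mat g 2 2 - 1 ∈ S.pE 1}

/-- The congruence subgroup of level `n` (used to express smoothness), as a set. -/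
def cong (n : ℕ) : Set S.GG := {g | ∀ i j, S.mat g i j - (1 : S.M3) i j ∈ S.pE n}

def alphaM : S.M3 := !![S.ϖ⁻¹, 0, 0; 0, 1, 0; 0, 0, S.ϖ]

def alphaMinv : S.M3 := !![S.ϖ, 0, 0; 0, 1, 0; 0, 0, S.ϖ⁻¹]

lemma alpha_mul_inv : S.alphaM * S.alphaMinv = 1 := by
  ext i j
  fin_cases i <;> fin_cases j <;>
    simp [alphaM, alphaMinv, Matrix.mul_apply, Fin.sum_univ_three, Matrix.one_apply,
      Matrix.vecHead, Matrix.vecTail, inv_mul_cancel₀ S.unif_ne, mul_inv_cancel₀ S.unif_ne]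

lemma alpha_inv_mul : S.alphaMinv * S.alphaM = 1 := by
  ext i j
  fin_cases i <;> fin_cases j <;>
    simp [alphaM, alphaMinv, Matrix.mul_apply, Fin.sum_univ_three, Matrix.one_apply,
      Matrix.vecHead, Matrix.vecTail, inv_mul_cancel₀ S.unif_ne, mul_inv_cancel₀ S.unif_ne]

def alphaU : Matrix.GeneralLinearGroup (Fin 3) S.E :=
  ⟨S.alphaM, S.alphaMinv, S.alpha_mul_inv, S.alpha_inv_mul⟩

lemma alphaU_mem : S.alphaU ∈ S.Gsub := by
  show ((S.alphaU : S.M3)).transpose * S.betaM * ((S.alphaU : S.M3).map S.conj) = S.betaM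
  have : (S.alphaU : S.M3) = S.alphaM := rfl
  rw [this]
  ext i j
  fin_cases i <;> fin_cases j <;>
    simp [alphaM, betaM, Matrix.mul_apply, Fin.sum_univ_three, Matrix.map_apply,
      Matrix.transpose_apply, Matrix.vecHead, Matrix.vecTail, map_inv₀, S.unif_conj,
      inv_mul_cancel₀ S.unif_ne, mul_inv_cancel₀ S.unif_ne]

/-- The element `α = diag(ϖ⁻¹, 1, ϖ)` of `G`. -/
def alphaE : S.GG := ⟨S.alphaU, S.alphaU_mem⟩

lemma beta_mul_beta : S.betaM * S.betaM = 1 := by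
  ext i j
  fin_cases i <;> fin_cases j <;>
    simp [betaM, Matrix.mul_apply, Fin.sum_univ_three, Matrix.one_apply,
      Matrix.vecHead, Matrix.vecTail]

def betaU : Matrix.GeneralLinearGroup (Fin 3) S.E :=
  ⟨S.betaM, S.betaM, S.beta_mul_beta, S.beta_mul_beta⟩

lemma betaU_mem : S.betaU ∈ S.Gsub := by
  show ((S.betaU : S.M3)).transpose * S.betaM * ((S.betaU : S.M3).map S.conj) = S.betaM
  have : (S.betaU : S.M3) = S.betaM := rfl
  rw [this]
  ext i j
  fin_cases i <;> fin_cases j <;>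
    simp [betaM, Matrix.mul_apply, Fin.sum_univ_three, Matrix.map_apply, Matrix.transpose_apply,
      Matrix.vecHead, Matrix.vecTail]

/-- The element `β` of `G`. -/
def betaE : S.GG := ⟨S.betaU, S.betaU_mem⟩

/-- The element `β' = β * α⁻¹` of `G`. -/
def betaPr : S.GG := S.betaE * S.alphaE⁻¹

/-- A finite set `U` is a set of representatives for the cosets `A/B`. -/
def IsReps (A B : Set S.GG) (U : Finset S.GG) : Prop :=
  (↑U : Set S.GG) ⊆ A ∧ ∀ a ∈ A, ∃! u, u ∈ U ∧ a⁻¹ * u ∈ B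

/-- The residue field `k_E` of `E`. -/
abbrev kE := S.O ⧸ S.mI

/-- The residue map `o_E → k_E`. -/
def resmap : S.O →+* S.kE := Ideal.Quotient.mk S.mI

/-- The group `L_{q³} = {(x,t) ∈ k_E² : x x̄ + t + t̄ = 0}` (where `x̄ = x^q`). -/
def Lbig : Set (S.kE × S.kE) := {z | z.1 * z.1 ^ S.q + z.2 + z.2 ^ S.q = 0}

/-- The group `L_q = {(0,t) ∈ k_E² : t + t̄ = 0}`. -/
def Lsmall : Set (S.kE × S.kE) := {z | z.1 = 0 ∧ z.2 + z.2 ^ S.q = 0}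

/-- `L_{q^t}` for `t ∈ {1,3}`. -/
def Lof (t : ℕ) : Set (S.kE × S.kE) := if t = 3 then S.Lbig else S.Lsmall

end Setting

/-- A choice of one of the two maximal compact open subgroups `K ∈ {K₀, K₁}` of `G`,
together with its maximal normal pro-p subgroup `K¹`, the (pro-p) Iwahori subgroups
`I_K ⊇ I_{1,K}`, the opposite pro-p Iwahori `I'_{1,K}`, the element
`β_K ∈ K ∩ {β, β'}`, and the integers `n_K, m_K, t_K`. -/
structure Chamber (S : Setting) where
  K : Subgroup S.GG
  KoneS : Set S.GG
  IK : Set S.GG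
  I1 : Set S.GG
  I1' : Set S.GG
  βK : S.GG
  nK : ℤ
  mK : ℤ
  tK : ℕ
  cases :
    ((K : Set S.GG) = S.K0set ∧ KoneS = S.Kone0 ∧ IK = S.IK0 ∧ I1 = S.I1K0 ∧ I1' = S.I1'K0 ∧
      βK = S.betaE ∧ nK = 0 ∧ mK = 1 ∧ tK = 3) ∨
    ((K : Set S.GG) = S.K1set ∧ KoneS = S.Kone1 ∧ IK = S.IK1 ∧ I1 = S.I1K1 ∧ I1' = S.I1'K1 ∧
      βK = S.betaPr ∧ nK = -1 ∧ mK = 2 ∧ tK = 1)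

namespace Chamber

variable {S : Setting} (C : Chamber S)

/-- `H₀ = H ∩ I_K`. -/
def H0 : Set S.GG := S.Hset ∩ C.IK

/-- `H₁ = H ∩ I_{1,K}`. -/
def H1 : Set S.GG := S.Hset ∩ C.I1

end Chamber

section RepTheory

variable {S : Setting} (C : Chamber S)
variable (𝔽 : Type) [Field 𝔽]

section Generic

variable {G₀ : Type} [Monoid G₀] {V : Type} [AddCommGroup V] [Module 𝔽 V]

/-- A submodule is invariant under a representation. -/
def Invt (ρ : Representation 𝔽 G₀ V) (Ssub : Submodule 𝔽 V) : Prop :=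
  ∀ g v, v ∈ Ssub → ρ g v ∈ Ssub

/-- The subrepresentation generated by a vector (the span of its orbit). -/
def orbitSpan (ρ : Representation 𝔽 G₀ V) (v : V) : Submodule 𝔽 V :=
  Submodule.span 𝔽 {w | ∃ g, w = ρ g v}

/-- The subrepresentation generated by a vector under a subset `A` of the group. -/
def orbitSpanOn (ρ : Representation 𝔽 G₀ V) (A : Set G₀) (v : V) : Submodule 𝔽 V :=
  Submodule.span 𝔽 {w | ∃ g ∈ A, w = ρ g v}

/-- The quotient of a representation by an invariant submodule `N` is irreducible:
equivalently (by the lattice correspondence), `N ≠ ⊤` and any invariant submodule lying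
between `N` and `⊤` equals `N` or `⊤`. -/
def QuotientIrreducible (ρ : Representation 𝔽 G₀ V) (N : Submodule 𝔽 V) : Prop :=
  N ≠ ⊤ ∧ ∀ Ssub : Submodule 𝔽 V, Invt 𝔽 ρ Ssub → N ≤ Ssub → Ssub = N ∨ Ssub = ⊤

/-- The submodule of vectors invariant under all elements of the subset `A`. -/
def invariantsOn (ρ : Representation 𝔽 G₀ V) (A : Set G₀) : Submodule 𝔽 V where
  carrier := {v | ∀ g ∈ A, ρ g v = v}
  add_mem' := by
    intro a b ha hb g hg
    rw [map_add, ha g hg, hb g hg]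
  zero_mem' := by
    intro g hg
    rw [map_zero]
  smul_mem' := by
    intro c a ha g hg
    rw [map_smul, ha g hg]

/-- The space `Hom_G(ρ₁, ρ₂)` of equivariant linear maps, as a submodule of the linear maps. -/
def EquivHomSub {V₂ : Type} [AddCommGroup V₂] [Module 𝔽 V₂]
    (ρ₁ : Representation 𝔽 G₀ V) (ρ₂ : Representation 𝔽 G₀ V₂) :
    Submodule 𝔽 (V →ₗ[𝔽] V₂) where
  carrier := {φ | ∀ g x, φ (ρ₁ g x) = ρ₂ g (φ x)}
  add_mem' := by
    intro a b ha hb g x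
    simp only [LinearMap.add_apply, ha g x, hb g x, map_add]
  zero_mem' := by
    intro g x
    simp only [LinearMap.zero_apply, map_zero]
  smul_mem' := by
    intro c a ha g x
    simp only [LinearMap.smul_apply, ha g x, map_smul]

end Generic

section Weight

variable (W : Type) [AddCommGroup W] [Module 𝔽 W]
variable (σ : Representation 𝔽 ↥C.K W)

/-- Extension of `σ` to all of `G` (by `1` outside `K`); used to avoid coercion issues. -/
def sigma' : S.GG → Module.End 𝔽 W := fun g => if h : g ∈ C.K then σ ⟨g, h⟩ else 1

/-- `σ` is a weight of `K`: an irreducible smooth representation of `K` over `𝔽`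
factoring through `Γ_K = K / K¹` (automatically finite dimensional). -/
def IsWeight : Prop :=
  Nontrivial W ∧ FiniteDimensional 𝔽 W ∧
  (∀ Ssub : Submodule 𝔽 W, (∀ (k : ↥C.K) (w : W), w ∈ Ssub → σ k w ∈ Ssub) → Ssub = ⊥ ∨ Ssub = ⊤) ∧
  (∀ (g : S.GG) (hg : g ∈ C.K), g ∈ C.KoneS → σ ⟨g, hg⟩ = LinearMap.id)

/-- `σ` is one dimensional of the form `χ ∘ det`. -/
def IsDetWeight : Prop :=
  Module.finrank 𝔽 W = 1 ∧
  ∃ c : S.E → 𝔽, ∀ (g : S.GG) (hg : g ∈ C.K) (w : W), σ ⟨g, hg⟩ w = c ((S.mat g).det) • w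

/-- `j_σ : σ → σ` is the composition of the coinvariant projection `σ → σ_{I'_{1,K}}`
with the inverse of the natural isomorphism `σ^{I_{1,K}} ≅ σ_{I'_{1,K}}`:
it restricts to the identity on `σ^{I_{1,K}}` and kills the augmentation part of
`σ` with respect to `I'_{1,K}`. -/
def IsJ (jσ : W →ₗ[𝔽] W) : Prop :=
  (∀ w : W, (∀ g ∈ C.I1, sigma' C 𝔽 W σ g w = w) → jσ w = w) ∧
  (∀ (w : W) (g : S.GG), g ∈ C.I1' → jσ (sigma' C 𝔽 W σ g w - w) = 0)

/-- The defining conditions of the compact induction `ind_K^G σ`: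
`K`-equivariance on the left and compact support (finitely many cosets `K g`). -/
def IndCarrier : Set (S.GG → W) :=
  {f | (∀ (k : S.GG) (hk : k ∈ C.K) (g : S.GG), f (k * g) = σ ⟨k, hk⟩ (f g)) ∧
       ∃ s : Finset S.GG, ∀ g : S.GG, f g ≠ 0 → ∃ k ∈ C.K, ∃ t ∈ s, g = k * t}

/-- The compact induction `ind_K^G σ`, as a submodule of `G → W`. -/
def IndSub : Submodule 𝔽 (S.GG → W) where
  carrier := IndCarrier C 𝔽 W σ
  add_mem' := by
    rintro f g ⟨hf1, sf, hf2⟩ ⟨hg1, sg, hg2⟩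
    refine ⟨fun k hk x => by simp [hf1 k hk x, hg1 k hk x], sf ∪ sg, fun x hx => ?_⟩
    by_cases h : f x ≠ 0
    · obtain ⟨k, hk, t, ht, rfl⟩ := hf2 x h
      exact ⟨k, hk, t, Finset.mem_union_left _ ht, rfl⟩
    · push_neg at h
      have hgx : g x ≠ 0 := by
        intro h0
        apply hx
        simp [Pi.add_apply, h, h0]
      obtain ⟨k, hk, t, ht, rfl⟩ := hg2 x hgx
      exact ⟨k, hk, t, Finset.mem_union_right _ ht, rfl⟩
  zero_mem' := ⟨fun k hk g => by simp, ∅, fun g hg => absurd rfl hg⟩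
  smul_mem' := by
    rintro c f ⟨hf1, sf, hf2⟩
    refine ⟨fun k hk g => by simp [hf1 k hk g], sf, fun x hx => ?_⟩
    refine hf2 x ?_
    intro h0
    apply hx
    simp [h0]

lemma indAct_mem (g : S.GG) {f : S.GG → W} (hf : f ∈ IndCarrier C 𝔽 W σ) :
    (fun x => f (x * g)) ∈ IndCarrier C 𝔽 W σ := by
  obtain ⟨h1, s, h2⟩ := hf
  refine ⟨fun k hk x => ?_, s.image (· * g⁻¹), ?_⟩
  · show f (k * x * g) = _
    rw [mul_assoc]
    exact h1 k hk (x * g)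
  intro x hx
  obtain ⟨k, hk, t, ht, hxg⟩ := h2 (x * g) hx
  refine ⟨k, hk, t * g⁻¹, Finset.mem_image_of_mem _ ht, ?_⟩
  rw [← mul_assoc, ← hxg, mul_assoc, mul_inv_cancel, mul_one]

/-- The representation of `G` on `ind_K^G σ` by right translation. -/
def indRep : Representation 𝔽 S.GG ↥(IndSub C 𝔽 W σ) where
  toFun g :=
    { toFun := fun f => ⟨fun x => (f : S.GG → W) (x * g), indAct_mem C 𝔽 W σ g f.2⟩
      map_add' := fun f1 f2 => Subtype.ext (funext fun x => rfl)
      map_smul' := fun c f => Subtype.ext (funext fun x => rfl) }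
  map_one' := LinearMap.ext fun f => Subtype.ext (funext fun x => by simp [mul_one])
  map_mul' g h := LinearMap.ext fun f => Subtype.ext (funext fun x => by simp [mul_assoc])

/-- The function `[g, v] ∈ ind_K^G σ`: supported on `K g⁻¹`, with value `v` at `g⁻¹`. -/
def stdFn (g : S.GG) (v : W) : S.GG → W :=
  fun x => if h : x * g ∈ C.K then σ ⟨x * g, h⟩ v else 0

/-- The characterization of the family `f_n` (`n ∈ ℤ`) of `I_{1,K}`-invariant elements of
`ind_K^G σ`: `f_n` is supported on `K α⁻ⁿ I_{1,K}` and has value at `α⁻ⁿ` equal to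
`σ(β_K) v₀` for `n > 0` and `v₀` for `n ≤ 0`, where `v₀` is a fixed nonzero vector of
`σ^{I_{1,K}}`. -/
def IsFFamily (v0 : W) (ff : ℤ → ↥(IndSub C 𝔽 W σ)) : Prop :=
  v0 ≠ 0 ∧ (∀ g ∈ C.I1, sigma' C 𝔽 W σ g v0 = v0) ∧
  (∀ (n : ℤ) (g : S.GG), g ∈ C.I1 → indRep C 𝔽 W σ g (ff n) = ff n) ∧
  (∀ (n : ℤ) (x : S.GG), (ff n : S.GG → W) x ≠ 0 →
    ∃ k ∈ C.K, ∃ i ∈ C.I1, x = k * S.alphaE ^ (-n) * i) ∧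
  (∀ n : ℤ, 0 < n → (ff n : S.GG → W) (S.alphaE ^ (-n)) = sigma' C 𝔽 W σ C.βK v0) ∧
  (∀ n : ℤ, n ≤ 0 → (ff n : S.GG → W) (S.alphaE ^ (-n)) = v0)

/-- The characterization of the Hecke operator `T ∈ End_G(ind_K^G σ)`:
it is `G`-equivariant and satisfies
`T [1, v] = ∑_{u ∈ N_{n_K}/N_{n_K+2}} [u α⁻¹, j_σ σ(u⁻¹) v]
  + ∑_{u ∈ N_{n_K+1}/N_{n_K+2}} [β_K u α⁻¹, j_σ σ(β_K) v]`. -/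
def IsHeckeT (jσ : W →ₗ[𝔽] W) (T : Module.End 𝔽 ↥(IndSub C 𝔽 W σ)) : Prop :=
  (∀ (g : S.GG) (x : ↥(IndSub C 𝔽 W σ)),
    T (indRep C 𝔽 W σ g x) = indRep C 𝔽 W σ g (T x)) ∧
  (∀ (v : W) (x : ↥(IndSub C 𝔽 W σ)), (x : S.GG → W) = stdFn C 𝔽 W σ 1 v →
    ∀ (U2 U1 : Finset S.GG),
      S.IsReps (S.Nk C.nK) (S.Nk (C.nK + 2)) U2 →
      S.IsReps (S.Nk (C.nK + 1)) (S.Nk (C.nK + 2)) U1 →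
      ((T x : S.GG → W)) =
        (∑ u ∈ U2, stdFn C 𝔽 W σ (u * S.alphaE⁻¹) (jσ (sigma' C 𝔽 W σ u⁻¹ v))) +
        ∑ u ∈ U1, stdFn C 𝔽 W σ (C.βK * u * S.alphaE⁻¹) (jσ (sigma' C 𝔽 W σ C.βK v)))

/-- The eigencharacter `χ_σ` of `H₀/H₁` afforded by the (one-dimensional) space
`σ^{I_{1,K}}` with chosen basis vector `v₀`. -/
def IsChi (v0 : W) (χ : S.GG → 𝔽) : Prop :=
  (∀ h ∈ C.H0, sigma' C 𝔽 W σ h v0 = χ h • v0)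

/-- Right translation on functions `K → 𝔽` (the action on a (finite) principal series). -/
def PSact (k : ↥C.K) (f : ↥C.K → 𝔽) : ↥C.K → 𝔽 := fun x => f (x * k)

/-- The (inflation to `K` of the) finite principal series `Ind_𝔹^{Γ_K} χ`:
functions on `K`, invariant under right translation by `K¹`, left `I_{1,K}`-invariant and
left `(H₀, χ)`-equivariant. -/
def PSchiSub (χ : S.GG → 𝔽) : Submodule 𝔽 (↥C.K → 𝔽) where
  carrier := {f | (∀ b : ↥C.K, (b : S.GG) ∈ C.I1 → ∀ x, f (b * x) = f x) ∧
                  (∀ h : ↥C.K, (h : S.GG) ∈ C.H0 → ∀ x, f (h * x) = χ (h : S.GG) * f x) ∧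
                  (∀ z : ↥C.K, (z : S.GG) ∈ C.KoneS → ∀ x, f (x * z) = f x)}
  add_mem' := by
    rintro f g ⟨hf1, hf2, hf3⟩ ⟨hg1, hg2, hg3⟩
    exact ⟨fun b hb x => by simp [hf1 b hb x, hg1 b hb x],
           fun h hh x => by simp [hf2 h hh x, hg2 h hh x, mul_add],
           fun z hz x => by simp [hf3 z hz x, hg3 z hz x]⟩
  zero_mem' := ⟨fun b hb x => rfl, fun h hh x => by simp, fun z hz x => rfl⟩
  smul_mem' := by
    rintro c f ⟨hf1, hf2, hf3⟩
    refine ⟨fun b hb x => by simp [hf1 b hb x], fun h hh x => ?_, fun z hz x => by simp [hf3 z hz x]⟩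
    simp only [Pi.smul_apply, hf2 h hh x, smul_eq_mul]
    ring

/-- The principal series `Ind_𝔹^{Γ_K} 1` for the trivial character. -/
def PS1sub : Submodule 𝔽 (↥C.K → 𝔽) := PSchiSub C 𝔽 (fun _ => 1)

/-- `σ_{st}` is the Steinberg weight `st = (Ind_𝔹^{Γ_K} 1)/1`: there is a surjective
`K`-equivariant linear map from `Ind_𝔹^{Γ_K} 1` to it whose kernel is exactly the
constant functions. -/
def IsSteinberg {Wst : Type} [AddCommGroup Wst] [Module 𝔽 Wst]
    (σst : Representation 𝔽 ↥C.K Wst) : Prop :=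
  ∃ φ : ↥(PS1sub C 𝔽) →ₗ[𝔽] Wst, Function.Surjective φ ∧
    (∀ f : ↥(PS1sub C 𝔽), φ f = 0 ↔ ∃ c : 𝔽, (f : ↥C.K → 𝔽) = fun _ => c) ∧
    (∀ (k : ↥C.K) (f f' : ↥(PS1sub C 𝔽)),
      (f' : ↥C.K → 𝔽) = PSact C 𝔽 k (f : ↥C.K → 𝔽) → φ f' = σst k (φ f))

/-- `σ` is isomorphic to a twist of the Steinberg weight by a character. -/
def IsTwistSteinberg : Prop :=
  ∃ (c : ↥C.K →* 𝔽ˣ) (φ : ↥(PS1sub C 𝔽) →ₗ[𝔽] W), Function.Surjective φ ∧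
    (∀ f : ↥(PS1sub C 𝔽), φ f = 0 ↔ ∃ cc : 𝔽, (f : ↥C.K → 𝔽) = fun _ => cc) ∧
    (∀ (k : ↥C.K) (f f' : ↥(PS1sub C 𝔽)),
      (f' : ↥C.K → 𝔽) = PSact C 𝔽 k (f : ↥C.K → 𝔽) →
        φ f' = (c k : 𝔽) • σ k (φ f))


/-- The `K`-subrepresentation of the quotient `(ind_K^G σ) / (range T)` generated by the
image of a vector `v`. -/
def genQuot (T : Module.End 𝔽 ↥(IndSub C 𝔽 W σ)) (v : ↥(IndSub C 𝔽 W σ)) :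
    Submodule 𝔽 (↥(IndSub C 𝔽 W σ) ⧸ LinearMap.range T) :=
  Submodule.span 𝔽 {w | ∃ k ∈ C.K, w = Submodule.Quotient.mk (indRep C 𝔽 W σ k v)}

end Weight

/-- Smoothness of a representation of `G`: every vector is fixed by some congruence
subgroup (equivalently, has open stabilizer). -/
def SmoothRep {V : Type} [AddCommGroup V] [Module 𝔽 V] (ρ : Representation 𝔽 S.GG V) : Prop :=
  ∀ v : V, ∃ n : ℕ, ∀ g ∈ S.cong n, ρ g v = v

end RepTheory

end U21

namespace U21

namespace Setting

variable (S : Setting)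

lemma mem_pE_zero {z : S.E} : z ∈ S.pE 0 ↔ z ∈ S.O := by
  simp [pE]

lemma pE_add {k : ℤ} {x y : S.E} (hx : x ∈ S.pE k) (hy : y ∈ S.pE k) : x + y ∈ S.pE k := by
  obtain ⟨a, ha, rfl⟩ := hx
  obtain ⟨b, hb, rfl⟩ := hy
  exact ⟨a + b, S.O.add_mem ha hb, by ring⟩

lemma pE_neg {k : ℤ} {x : S.E} (hx : x ∈ S.pE k) : -x ∈ S.pE k := by
  obtain ⟨a, ha, rfl⟩ := hx
  exact ⟨-a, S.O.neg_mem ha, by ring⟩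

lemma pE_sub {k : ℤ} {x y : S.E} (hx : x ∈ S.pE k) (hy : y ∈ S.pE k) : x - y ∈ S.pE k := by
  rw [sub_eq_add_neg]
  exact S.pE_add hx (S.pE_neg hy)

lemma zero_mem_pE (k : ℤ) : (0 : S.E) ∈ S.pE k := ⟨0, S.O.zero_mem, by simp⟩

lemma pE_mul {k l : ℤ} {x y : S.E} (hx : x ∈ S.pE k) (hy : y ∈ S.pE l) :
    x * y ∈ S.pE (k + l) := by
  obtain ⟨a, ha, rfl⟩ := hx
  obtain ⟨b, hb, rfl⟩ := hy
  exact ⟨a * b, S.O.mul_mem ha hb, by rw [zpow_add₀ S.unif_ne]; ring⟩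

lemma pE_mono {k l : ℤ} (h : l ≤ k) {x : S.E} (hx : x ∈ S.pE k) : x ∈ S.pE l := by
  obtain ⟨a, ha, rfl⟩ := hx
  obtain ⟨n, hn⟩ := Int.eq_ofNat_of_zero_le (sub_nonneg.mpr h)
  refine ⟨S.ϖ ^ n * a, S.O.mul_mem (S.O.pow_mem S.unif_mem n) ha, ?_⟩
  have hk : k = l + (n : ℤ) := by omega
  rw [hk, zpow_add₀ S.unif_ne, zpow_natCast, mul_assoc]

lemma conj_pE {k : ℤ} {x : S.E} (hx : x ∈ S.pE k) : S.conj x ∈ S.pE k := by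
  obtain ⟨a, ha, rfl⟩ := hx
  exact ⟨S.conj a, S.conj_O a ha, by rw [map_mul, map_zpow₀, S.unif_conj]⟩

lemma unif_zpow_mem (k : ℤ) : S.ϖ ^ k ∈ S.pE k := ⟨1, S.O.one_mem, by simp⟩

lemma one_notMem_pE_one : (1 : S.E) ∉ S.pE 1 := by
  rintro ⟨w, hw, h⟩
  apply S.unif_not_unit
  refine IsUnit.of_mul_eq_one ⟨w, hw⟩ (Subtype.ext ?_)
  simpa using h.symm

lemma pE_sum {ι : Type*} (s : Finset ι) {k : ℤ} {f : ι → S.E} (h : ∀ i ∈ s, f i ∈ S.pE k) :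
    ∑ i ∈ s, f i ∈ S.pE k :=
  Finset.sum_induction f (· ∈ S.pE k) (fun _ _ => S.pE_add) (S.zero_mem_pE k) h

/-- `o_E` is a local ring with maximal ideal `p_E`. -/
lemma ne_zero_and_inv_mem {x : S.E} (hx : x ∈ S.O) (hx1 : x ∉ S.pE 1) : x ≠ 0 ∧ x⁻¹ ∈ S.O := by
  have h0 : x ≠ 0 := by
    rintro rfl
    exact hx1 (S.zero_mem_pE 1)
  refine ⟨h0, ?_⟩
  obtain ⟨n, u, hu⟩ := S.disc x h0
  rcases lt_or_ge 0 n with hn | hn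
  · exact absurd (S.pE_mono (show (1 : ℤ) ≤ n by omega) ⟨(u : S.O), (u : S.O).2, by rw [hu]; ring⟩) hx1
  · have hinv : (((u : S.O) : S.E))⁻¹ = ((u⁻¹ : S.Oˣ) : S.O) := by
      apply inv_eq_of_mul_eq_one_right
      exact congrArg Subtype.val u.mul_inv
    rw [← S.mem_pE_zero]
    refine S.pE_mono (show (0 : ℤ) ≤ -n by omega) ⟨((u⁻¹ : S.Oˣ) : S.O), SetLike.coe_mem _, ?_⟩
    rw [hu, mul_inv, hinv, zpow_neg, mul_comm]

/-- A unit of `o_E` whose norm is `1` modulo `p_E` is congruent to an element of norm `1`. -/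
lemma exists_norm_one {b : S.E} (hb : b ∈ S.O) (h : b * S.conj b - 1 ∈ S.pE 1) :
    ∃ b' ∈ S.O, b' * S.conj b' = 1 ∧ b - b' ∈ S.pE 1 := by
  by_cases h1 : 1 + b ∈ S.pE 1
  · exact ⟨-1, S.O.neg_mem S.O.one_mem, by simp, by simpa [add_comm] using h1⟩
  · have hc : 1 + S.conj b ∉ S.pE 1 := fun hc => h1 (by
      have := S.conj_pE hc
      simpa [S.conj_invol] using this)
    have hm : 1 + b ∈ S.O := S.O.add_mem S.O.one_mem hb
    have hcm : 1 + S.conj b ∈ S.O := S.O.add_mem S.O.one_mem (S.conj_O b hb)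
    obtain ⟨hb0, -⟩ := S.ne_zero_and_inv_mem hm h1
    obtain ⟨hc0, hcinv⟩ := S.ne_zero_and_inv_mem hcm hc
    refine ⟨(1 + b) * (1 + S.conj b)⁻¹, S.O.mul_mem hm hcinv, ?_, ?_⟩
    · simp only [map_mul, map_inv₀, map_add, map_one, S.conj_invol]
      field_simp
    · have : b - (1 + b) * (1 + S.conj b)⁻¹ = (b * S.conj b - 1) * (1 + S.conj b)⁻¹ := by
        field_simp
        ring
      rw [this]
      exact S.pE_mul (l := 0) h (S.mem_pE_zero.mpr hcinv)

@[simp] lemma mat_mul (g h : S.GG) : S.mat (g * h) = S.mat g * S.mat h := rfl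

@[simp] lemma mat_one : S.mat 1 = 1 := rfl

lemma mat_mul_mat_inv (g : S.GG) : S.mat g * S.mat g⁻¹ = 1 := by
  rw [← mat_mul, mul_inv_cancel, mat_one]

lemma mat_inv_mul_mat (g : S.GG) : S.mat g⁻¹ * S.mat g = 1 := by
  rw [← mat_mul, inv_mul_cancel, mat_one]

lemma mat_injective : Function.Injective S.mat :=
  fun _ _ h => Subtype.ext (Units.ext h)

lemma mat_inv_apply (g : S.GG) (i j : Fin 3) :
    S.mat g⁻¹ i j = S.conj (S.mat g j.rev i.rev) := by
  have hg : (S.mat g).transpose * S.betaM * (S.mat g).map S.conj = S.betaM := g.2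
  have hβ : S.betaM.map S.conj = S.betaM := by
    ext i j
    fin_cases i <;> fin_cases j <;> simp [betaM]
  have hg' : ((S.mat g).map S.conj).transpose * S.betaM * S.mat g = S.betaM := by
    have h := congrArg (fun A : S.M3 => A.map S.conj) hg
    have hmap : ((S.mat g).map S.conj).map S.conj = S.mat g := by
      ext i j
      simp [S.conj_invol]
    simpa only [Matrix.map_mul, hβ, hmap, Matrix.transpose_map] using h
  have hinv : S.betaM * ((S.mat g).map S.conj).transpose * S.betaM = S.mat g⁻¹ := by
    calc S.betaM * ((S.mat g).map S.conj).transpose * S.betaM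
        = S.betaM * (((S.mat g).map S.conj).transpose * S.betaM * S.mat g) * S.mat g⁻¹ := by
          simp only [mul_assoc, S.mat_mul_mat_inv, mul_one]
      _ = S.mat g⁻¹ := by rw [hg', S.beta_mul_beta, one_mul]
  rw [← hinv]
  fin_cases i <;> fin_cases j <;>
    simp [betaM, Matrix.mul_apply, Matrix.vecMul, dotProduct, Fin.sum_univ_three, Fin.rev]

/-- Matrices whose `(i,j)` entry lies in `p_E ^ (e i j)`. -/
def lat (e : Fin 3 → Fin 3 → ℤ) : Set S.M3 := {A | ∀ i j, A i j ∈ S.pE (e i j)}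

variable {S}

lemma lat_mul {e e' e'' : Fin 3 → Fin 3 → ℤ} (h : ∀ i k j, e'' i j ≤ e i k + e' k j)
    {A B : S.M3} (hA : A ∈ S.lat e) (hB : B ∈ S.lat e') : A * B ∈ S.lat e'' := by
  intro i j
  rw [Matrix.mul_apply]
  exact S.pE_sum _ fun k _ => S.pE_mono (h i k j) (S.pE_mul (hA i k) (hB k j))

lemma lat_mono {e e' : Fin 3 → Fin 3 → ℤ} (h : ∀ i j, e' i j ≤ e i j)
    {A : S.M3} (hA : A ∈ S.lat e) : A ∈ S.lat e' :=
  fun i j => S.pE_mono (h i j) (hA i j)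

lemma lat_add {e : Fin 3 → Fin 3 → ℤ} {A B : S.M3} (hA : A ∈ S.lat e) (hB : B ∈ S.lat e) :
    A + B ∈ S.lat e :=
  fun i j => S.pE_add (hA i j) (hB i j)

lemma diag_mem_lat {e : Fin 3 → Fin 3 → ℤ} (he : ∀ i, e i i = 0) {a b c : S.E}
    (ha : a ∈ S.O) (hb : b ∈ S.O) (hc : c ∈ S.O) :
    (!![a,0,0;0,b,0;0,0,c] : S.M3) ∈ S.lat e := by
  intro i j
  fin_cases i <;> fin_cases j <;>
    simp [he, mem_pE_zero, zero_mem_pE, ha, hb, hc]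

lemma one_mem_lat {e : Fin 3 → Fin 3 → ℤ} (he : ∀ i, e i i = 0) : (1 : S.M3) ∈ S.lat e := by
  intro i j
  by_cases h : i = j
  · subst h
    simp [he, mem_pE_zero, S.O.one_mem]
  · simp [h, zero_mem_pE]

variable (S)

lemma exists_diag {a b c : S.E} (hb : b * S.conj b = 1) (hac : a * S.conj c = 1) :
    ∃ h : S.GG, S.mat h = !![a,0,0;0,b,0;0,0,c] := by
  have hca : c * S.conj a = 1 := by
    have := congrArg S.conj hac
    rw [map_mul, S.conj_invol, map_one] at this
    rw [mul_comm, this]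
  have hb' : S.conj b * b = 1 := by rw [mul_comm, hb]
  have hac' : S.conj c * a = 1 := by rw [mul_comm, hac]
  have hca' : S.conj a * c = 1 := by rw [mul_comm, hca]
  refine ⟨⟨⟨!![a,0,0;0,b,0;0,0,c], !![S.conj c,0,0;0,S.conj b,0;0,0,S.conj a], ?_, ?_⟩, ?_⟩, rfl⟩
  · ext i j
    fin_cases i <;> fin_cases j <;> simp [Matrix.mul_apply, Fin.sum_univ_three, hb, hac, hca]
  · ext i j
    fin_cases i <;> fin_cases j <;> simp [Matrix.mul_apply, Fin.sum_univ_three, hb', hac', hca']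
  · change (!![a,0,0;0,b,0;0,0,c] : S.M3).transpose * S.betaM *
      (!![a,0,0;0,b,0;0,0,c] : S.M3).map S.conj = S.betaM
    ext i j
    fin_cases i <;> fin_cases j <;>
      simp [betaM, Matrix.mul_apply, Fin.sum_univ_three, hb, hac, hca]

lemma mat_alpha_conj_apply (g : S.GG) (i j : Fin 3) :
    S.mat (S.alphaE * g * S.alphaE⁻¹) i j =
      S.ϖ ^ ((i : ℤ) - (j : ℤ)) * S.mat g i j := by
  have h1 : S.mat S.alphaE = S.alphaM := rfl
  have h2 : S.mat S.alphaE⁻¹ = S.alphaMinv := rfl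
  have h0 := S.unif_ne
  rw [mat_mul, mat_mul, h1, h2]
  fin_cases i <;> fin_cases j <;>
    simp [alphaM, alphaMinv, Matrix.mul_apply, Matrix.vecMul, dotProduct,
      Fin.sum_univ_three] <;> try field_simp

end Setting

/-- The groups `K`, `I_K`, `I_{1,K}`, `K¹` are cut out by bounds on the valuations of matrix
entries; this records the bounds and the relations between them. -/
structure Pattern {S : Setting} (C : Chamber S) where
  eK : Fin 3 → Fin 3 → ℤ
  eI : Fin 3 → Fin 3 → ℤ
  eR : Fin 3 → Fin 3 → ℤ
  eJ : Fin 3 → Fin 3 → ℤ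
  mem_K : ∀ g, g ∈ C.K ↔ S.mat g ∈ S.lat eK
  mem_IK : ∀ g, g ∈ C.IK ↔ S.mat g ∈ S.lat eI
  mem_I1 : ∀ g, g ∈ C.I1 ↔ S.mat g - 1 ∈ S.lat eR
  mem_Kone : ∀ g, g ∈ C.KoneS ↔ S.mat g - 1 ∈ S.lat eJ
  eI_mul : ∀ i k j, eI i j ≤ eI i k + eI k j
  eI_mul_eR : ∀ i k j, eR i j ≤ eI i k + eR k j
  eR_mul_eI : ∀ i k j, eR i j ≤ eR i k + eI k j
  eK_mul_eJ : ∀ i k j, eJ i j ≤ eK i k + eJ k j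
  eJ_mul_eK : ∀ i k j, eJ i j ≤ eJ i k + eK k j
  eR_le_eJ : ∀ i j, eR i j ≤ eJ i j
  eI_le_eR : ∀ i j, eI i j ≤ eR i j
  eK_le_eI : ∀ i j, eK i j ≤ eI i j
  eJ_le : ∀ i j, eJ i j ≤ eK i j + 1
  eI_diag : ∀ i, eI i i = 0
  eR_diag : ∀ i, eR i i = 1
  eR_off : ∀ i j, i ≠ j → eR i j = eI i j
  eI_off : ∀ i k, i ≠ k → 1 ≤ eI i k + eI k i
  eI_rev : ∀ i j, eI i j = eI (Fin.rev j) (Fin.rev i)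
  eI_alpha : ∀ i j : Fin 3, eI i j ≤ max (eK i j) ((i : ℤ) - (j : ℤ) + eK i j)
  βK_mem : C.βK ∈ C.K
  βK_sq : C.βK * C.βK = 1
  βK_diag : ∀ (h : S.GG) (a b c : S.E), S.mat h = !![a,0,0;0,b,0;0,0,c] →
    S.mat (C.βK * h * C.βK) = !![c,0,0;0,b,0;0,0,a]

namespace Pattern

variable {S : Setting} {C : Chamber S}

open Setting

lemma mat_betaPr (S : Setting) : S.mat S.betaPr = !![0,0,S.ϖ⁻¹;0,1,0;S.ϖ,0,0] := by
  have : S.mat S.betaPr = S.betaM * S.alphaMinv := rfl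
  rw [this]
  ext i j
  fin_cases i <;> fin_cases j <;>
    simp [betaM, alphaMinv, Matrix.mul_apply, Fin.sum_univ_three]

lemma mat_betaE (S : Setting) : S.mat S.betaE = !![0,0,1;0,1,0;1,0,0] := rfl

theorem nonempty_pattern (C : Chamber S) : Nonempty (Pattern C) := by
  have hO1 : ∀ x : S.E, x - 1 ∈ S.pE 1 → x ∈ S.O := fun x hx => by
    have := S.O.add_mem (S.mem_pE_zero.mp (S.pE_mono zero_le_one hx)) S.O.one_mem
    simpa using this
  have hO0 : ∀ x : S.E, x ∈ S.pE 1 → x ∈ S.O := fun x hx =>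
    S.mem_pE_zero.mp (S.pE_mono zero_le_one hx)
  have hP21 : ∀ x : S.E, x ∈ S.pE 2 → x ∈ S.pE 1 := fun x hx => S.pE_mono (by norm_num) hx
  have hOm1 : ∀ x : S.E, x ∈ S.O → x ∈ S.pE (-1) := fun x hx =>
    S.pE_mono (by norm_num) (S.mem_pE_zero.mpr hx)
  have h0 := S.unif_ne
  rcases C.cases with ⟨hK, hJ, hI, h1, -, hβ, -⟩ | ⟨hK, hJ, hI, h1, -, hβ, -⟩
  · have hK' : ∀ g, g ∈ C.K ↔ g ∈ S.K0set := fun g => by rw [← hK]; rfl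
    refine ⟨⟨![![0,0,0],![0,0,0],![0,0,0]], ![![0,0,0],![1,0,0],![1,1,0]],
      ![![1,0,0],![1,1,0],![1,1,1]], ![![1,1,1],![1,1,1],![1,1,1]],
      fun g => ?_, fun g => ?_, fun g => ?_, fun g => ?_,
      by decide, by decide, by decide, by decide, by decide, by decide, by decide, by decide,
      by decide, by decide, by decide, by decide, by decide, by decide, by decide,
      ?_, ?_, ?_⟩⟩
    · simp [hK', K0set, lat, Fin.forall_fin_succ, mem_pE_zero]
    · simp [hI, IK0, K0set, lat, Fin.forall_fin_succ, mem_pE_zero]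
      grind
    · simp [h1, I1K0, IK0, K0set, lat, Fin.forall_fin_succ, mem_pE_zero]
      grind
    · simp [hJ, Kone0, lat, Fin.forall_fin_succ]
    · rw [hK', hβ]
      simp [K0set, mat_betaE, Fin.forall_fin_succ, S.O.one_mem, S.O.zero_mem]
    · rw [hβ]
      exact S.mat_injective S.beta_mul_beta
    · intro h a b c hh
      rw [hβ, mat_mul, mat_mul, hh, mat_betaE]
      ext i j
      fin_cases i <;> fin_cases j <;> simp [Matrix.mul_apply, Fin.sum_univ_three]
  · have hK' : ∀ g, g ∈ C.K ↔ g ∈ S.K1set := fun g => by rw [← hK]; rfl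
    refine ⟨⟨![![0,0,-1],![1,0,0],![1,1,0]], ![![0,0,-1],![1,0,0],![2,1,0]],
      ![![1,0,-1],![1,1,0],![2,1,1]], ![![1,0,0],![1,1,0],![2,1,1]],
      fun g => ?_, fun g => ?_, fun g => ?_, fun g => ?_,
      by decide, by decide, by decide, by decide, by decide, by decide, by decide, by decide,
      by decide, by decide, by decide, by decide, by decide, by decide, by decide,
      ?_, ?_, ?_⟩⟩
    · simp [hK', K1set, lat, Fin.forall_fin_succ, mem_pE_zero]
      grind
    · simp [hI, IK1, K1set, lat, Fin.forall_fin_succ, mem_pE_zero]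
      grind
    · simp [h1, I1K1, IK1, K1set, lat, Fin.forall_fin_succ, mem_pE_zero]
      grind
    · simp [hJ, Kone1, K1set, lat, Fin.forall_fin_succ, mem_pE_zero]
      grind
    · rw [hK', hβ]
      have hu := S.unif_zpow_mem 1
      have hv := S.unif_zpow_mem (-1)
      simp only [zpow_one, zpow_neg] at hu hv
      simp [K1set, mat_betaPr, S.O.one_mem, S.O.zero_mem, S.zero_mem_pE, hu, hv]
    · rw [hβ]
      apply S.mat_injective
      rw [mat_mul, mat_betaPr, mat_one]
      ext i j
      fin_cases i <;> fin_cases j <;> simp [Matrix.mul_apply, Fin.sum_univ_three, h0]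
    · intro h a b c hh
      rw [hβ, mat_mul, mat_mul, hh, mat_betaPr]
      ext i j
      fin_cases i <;> fin_cases j <;>
        simp [Matrix.mul_apply, Fin.sum_univ_three] <;> field_simp

lemma mem_IK_of_mem_I1 (P : Pattern C) {g : S.GG} (hg : g ∈ C.I1) : g ∈ C.IK := by
  rw [P.mem_I1] at hg
  rw [P.mem_IK]
  simpa using lat_add (lat_mono P.eI_le_eR hg) (one_mem_lat P.eI_diag)

lemma mem_K_of_mem_IK (P : Pattern C) {g : S.GG} (hg : g ∈ C.IK) : g ∈ C.K := by
  rw [P.mem_K]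
  exact lat_mono P.eK_le_eI ((P.mem_IK g).mp hg)

lemma mul_mem_IK (P : Pattern C) {g h : S.GG} (hg : g ∈ C.IK) (hh : h ∈ C.IK) :
    g * h ∈ C.IK := by
  rw [P.mem_IK] at *
  exact lat_mul P.eI_mul hg hh

lemma inv_mem_IK (P : Pattern C) {g : S.GG} (hg : g ∈ C.IK) : g⁻¹ ∈ C.IK := by
  rw [P.mem_IK] at *
  intro i j
  rw [S.mat_inv_apply, P.eI_rev]
  exact S.conj_pE (hg _ _)

/-- The Iwahori subgroup as a subgroup of `K`. -/
def iwahori (P : Pattern C) : Subgroup C.K where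
  carrier := {x | (x : S.GG) ∈ C.IK}
  one_mem' := (P.mem_IK _).mpr (one_mem_lat P.eI_diag)
  mul_mem' := P.mul_mem_IK
  inv_mem' := P.inv_mem_IK

lemma inv_mul_mem_I1 (P : Pattern C) {g h : S.GG} (hh : h ∈ C.IK)
    (hgh : S.mat g - S.mat h ∈ S.lat P.eR) : h⁻¹ * g ∈ C.I1 := by
  rw [P.mem_I1, mat_mul, ← S.mat_inv_mul_mat h, ← mul_sub]
  exact lat_mul P.eI_mul_eR ((P.mem_IK _).mp (P.inv_mem_IK hh)) hgh

lemma conj_mem_I1 (P : Pattern C) {b x : S.GG} (hb : b ∈ C.I1) (hx : x ∈ C.IK) :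
    x⁻¹ * b * x ∈ C.I1 := by
  have h : S.mat (x⁻¹ * b * x) - 1 = S.mat x⁻¹ * (S.mat b - 1) * S.mat x := by
    rw [mat_mul, mat_mul, mul_sub, sub_mul, mul_one, S.mat_inv_mul_mat]
  rw [P.mem_I1, h]
  exact lat_mul P.eR_mul_eI
    (lat_mul P.eI_mul_eR ((P.mem_IK _).mp (P.inv_mem_IK hx)) ((P.mem_I1 _).mp hb))
    ((P.mem_IK _).mp hx)

lemma conj_Kone_mem_I1 (P : Pattern C) {z k : S.GG} (hz : z ∈ C.KoneS) (hk : k ∈ C.K) :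
    k⁻¹ * z * k ∈ C.I1 := by
  have h : S.mat (k⁻¹ * z * k) - 1 = S.mat k⁻¹ * (S.mat z - 1) * S.mat k := by
    rw [mat_mul, mat_mul, mul_sub, sub_mul, mul_one, S.mat_inv_mul_mat]
  rw [P.mem_I1, h]
  exact lat_mono P.eR_le_eJ (lat_mul P.eJ_mul_eK
    (lat_mul P.eK_mul_eJ ((P.mem_K _).mp (C.K.inv_mem hk)) ((P.mem_Kone _).mp hz))
    ((P.mem_K _).mp hk))

lemma alpha_conj_mem_IK (P : Pattern C) {k : S.GG} (hk : k ∈ C.K)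
    (hk' : S.alphaE * k * S.alphaE⁻¹ ∈ C.K) : S.alphaE * k * S.alphaE⁻¹ ∈ C.IK := by
  rw [P.mem_IK]
  rw [P.mem_K] at hk hk'
  intro i j
  refine S.pE_mono (P.eI_alpha i j) ?_
  rcases max_cases (P.eK i j) ((i : ℤ) - (j : ℤ) + P.eK i j) with ⟨h, -⟩ | ⟨h, -⟩ <;> rw [h]
  · exact hk' i j
  · rw [S.mat_alpha_conj_apply]
    exact S.pE_mul (S.unif_zpow_mem _) (hk i j)

lemma βK_conj_mem_H0 (P : Pattern C) {h : S.GG} (hh : h ∈ C.H0) :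
    C.βK * h * C.βK ∈ C.H0 := by
  obtain ⟨⟨a, b, c, hm⟩, hI⟩ := hh
  have hm' := P.βK_diag h a b c hm
  refine ⟨⟨c, b, a, hm'⟩, ?_⟩
  rw [P.mem_IK] at hI ⊢
  have hd : ∀ i, S.mat h i i ∈ S.O := fun i => by
    have := hI i i
    rwa [P.eI_diag, mem_pE_zero] at this
  rw [hm']
  exact diag_mem_lat P.eI_diag (by simpa [hm] using hd 2) (by simpa [hm] using hd 1)
    (by simpa [hm] using hd 0)

lemma diag_mul_conj_sub_one_mem (P : Pattern C) {g : S.GG} (hg : g ∈ C.IK) (i : Fin 3) :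
    S.mat g i i * S.conj (S.mat g i.rev i.rev) - 1 ∈ S.pE 1 := by
  have hi := (P.mem_IK _).mp (P.inv_mem_IK hg)
  rw [P.mem_IK] at hg
  have h : (S.mat g * S.mat g⁻¹) i i = 1 := by rw [S.mat_mul_mat_inv, Matrix.one_apply_eq]
  rw [Matrix.mul_apply, ← Finset.add_sum_erase _ _ (Finset.mem_univ i)] at h
  rw [← S.mat_inv_apply g i i, ← h, sub_add_cancel_left]
  refine S.pE_neg (S.pE_sum _ fun k hk => ?_)
  exact S.pE_mono (P.eI_off i k (Finset.ne_of_mem_erase hk).symm) (S.pE_mul (hg i k) (hi k i))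

/-- The Iwahori decomposition `I_K = H₀ I_{1,K}`. -/
lemma exists_H0_mul_I1 (P : Pattern C) {g : S.GG} (hg : g ∈ C.IK) :
    ∃ h ∈ C.H0, h⁻¹ * g ∈ C.I1 := by
  have hd : ∀ i, S.mat g i i ∈ S.O := fun i => by
    have := (P.mem_IK g).mp hg i i
    rwa [P.eI_diag, mem_pE_zero] at this
  have h0 := P.diag_mul_conj_sub_one_mem hg 0
  have h1 := P.diag_mul_conj_sub_one_mem hg 1
  have h2 := P.diag_mul_conj_sub_one_mem hg 2
  simp only [show Fin.rev (0 : Fin 3) = 2 from rfl, show Fin.rev (1 : Fin 3) = 1 from rfl,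
    show Fin.rev (2 : Fin 3) = 0 from rfl] at h0 h1 h2
  obtain ⟨b, hbO, hb, hbs⟩ := S.exists_norm_one (hd 1) h1
  set a := S.mat g 0 0 with ha
  have haO : S.conj a ∈ S.O := S.conj_O _ (hd 0)
  have ha1 : S.conj a ∉ S.pE 1 := fun h => by
    refine S.one_notMem_pE_one ?_
    have := S.pE_sub (S.pE_mul (S.mem_pE_zero.mpr (hd 2)) h) h2
    simpa using this
  obtain ⟨hane, hainv⟩ := S.ne_zero_and_inv_mem haO ha1
  have hac : a * S.conj (S.conj a)⁻¹ = 1 := by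
    rw [map_inv₀, S.conj_invol]
    exact mul_inv_cancel₀ fun h => hane (by rw [h, map_zero])
  obtain ⟨h, hm⟩ := S.exists_diag hb hac
  have hI : h ∈ C.IK := by
    rw [P.mem_IK, hm]
    exact diag_mem_lat P.eI_diag (hd 0) hbO hainv
  refine ⟨h, ⟨⟨_, _, _, hm⟩, hI⟩, P.inv_mul_mem_I1 hI fun i j => ?_⟩
  by_cases hij : i = j
  · subst hij
    rw [P.eR_diag, Matrix.sub_apply, hm]
    fin_cases i
    · simp [← ha, S.zero_mem_pE]
    · simpa using hbs
    · have : S.mat g 2 2 - (S.conj a)⁻¹ = (S.mat g 2 2 * S.conj a - 1) * (S.conj a)⁻¹ := by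
        field_simp
      simpa [this] using S.pE_mul (l := 0) h2 (S.mem_pE_zero.mpr hainv)
  · have hz : S.mat h i j = 0 := by
      rw [hm]
      fin_cases i <;> fin_cases j <;> simp at hij ⊢
    rw [P.eR_off i j hij, Matrix.sub_apply, hz, sub_zero]
    exact (P.mem_IK g).mp hg i j

/-- The entries of an element of `K`, rescaled to be integral. -/
def scaledEntry (P : Pattern C) (x : C.K) (i j : Fin 3) : S.O :=
  ⟨S.ϖ ^ (-P.eK i j) * S.mat x i j, by
    have := S.pE_mul (S.unif_zpow_mem (-P.eK i j)) ((P.mem_K _).mp x.2 i j)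
    rwa [neg_add_cancel, mem_pE_zero] at this⟩

lemma mul_inv_mem_IK (P : Pattern C) {x y : C.K}
    (h : (fun i j => S.resmap (P.scaledEntry x i j)) = fun i j => S.resmap (P.scaledEntry y i j)) :
    (y : S.GG) * (x : S.GG)⁻¹ ∈ C.IK := by
  have hxy : S.mat y - S.mat x ∈ S.lat P.eJ := fun i j => by
    have h' := congrFun (congrFun h i) j
    rw [eq_comm, resmap, Ideal.Quotient.eq, S.hmI] at h'
    obtain ⟨w, hw, hxw⟩ := h'
    refine S.pE_mono (P.eJ_le i j) ⟨w, hw, ?_⟩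
    have h2 : S.ϖ ^ (-P.eK i j) * (S.mat y i j - S.mat x i j) = S.ϖ * w := by
      rw [← hxw, mul_sub]
      rfl
    rw [zpow_add₀ S.unif_ne, zpow_one, mul_assoc, ← h2, ← mul_assoc, ← zpow_add₀ S.unif_ne,
      add_neg_cancel, zpow_zero, one_mul, Matrix.sub_apply]
  apply P.mem_IK_of_mem_I1
  rw [P.mem_I1, mat_mul, ← S.mat_mul_mat_inv x, ← sub_mul]
  exact lat_mono P.eR_le_eJ (lat_mul P.eJ_mul_eK hxy ((P.mem_K _).mp (C.K.inv_mem x.2)))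

lemma finite_quotient (P : Pattern C) : Finite (Quotient (QuotientGroup.rightRel P.iwahori)) := by
  refine Finite.of_injective
    (fun c : Quotient (QuotientGroup.rightRel P.iwahori) =>
      fun i j => S.resmap (P.scaledEntry c.out i j)) fun c d h => ?_
  rw [← Quotient.out_eq c, ← Quotient.out_eq d, Quotient.eq, QuotientGroup.rightRel_apply]
  exact P.mul_inv_mem_IK h

end Pattern

section Translates

variable {S : Setting} {C : Chamber S} {𝔽 : Type} [Field 𝔽] {W : Type} [AddCommGroup W]
  [Module 𝔽 W] {σ : Representation 𝔽 ↥C.K W}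

lemma sigma'_of_mem {g : S.GG} (hg : g ∈ C.K) : sigma' C 𝔽 W σ g = σ ⟨g, hg⟩ := dif_pos hg

lemma sigma'_mul {g h : S.GG} (hg : g ∈ C.K) (hh : h ∈ C.K) :
    sigma' C 𝔽 W σ (g * h) = sigma' C 𝔽 W σ g * sigma' C 𝔽 W σ h := by
  rw [sigma'_of_mem hg, sigma'_of_mem hh, sigma'_of_mem (C.K.mul_mem hg hh), ← map_mul]
  rfl

lemma sigma'_one : sigma' C 𝔽 W σ 1 = 1 := by
  rw [sigma'_of_mem C.K.one_mem]
  exact map_one σ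

lemma sigma'_ne_zero {g : S.GG} (hg : g ∈ C.K) {w : W} (hw : w ≠ 0) :
    sigma' C 𝔽 W σ g w ≠ 0 := fun h => hw <| by
  have : sigma' C 𝔽 W σ (g⁻¹ * g) w = w := by rw [inv_mul_cancel, sigma'_one]; rfl
  rw [← this, sigma'_mul (C.K.inv_mem hg) hg, Module.End.mul_apply, h, map_zero]

lemma indSub_apply_mul (f : ↥(IndSub C 𝔽 W σ)) {k : S.GG} (hk : k ∈ C.K) (g : S.GG) :
    (f : S.GG → W) (k * g) = sigma' C 𝔽 W σ k ((f : S.GG → W) g) := by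
  rw [sigma'_of_mem hk]
  exact f.2.1 k hk g

lemma alpha_inv_mul_H0 {h : S.GG} (hh : h ∈ C.H0) : S.alphaE⁻¹ * h = h * S.alphaE⁻¹ := by
  obtain ⟨⟨a, b, c, hm⟩, -⟩ := hh
  have h2 : S.mat S.alphaE⁻¹ = S.alphaMinv := rfl
  apply S.mat_injective
  rw [S.mat_mul, S.mat_mul, hm, h2]
  ext i j
  fin_cases i <;> fin_cases j <;>
    simp [Setting.alphaMinv, Matrix.mul_apply, Fin.sum_univ_three, mul_comm]

/-- Let `f₁` be supported on `K a K`, with `f₁ (a x) = φ x • w` for `x ∈ K`, where `φ` is supported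
on `I_K` and transforms on the left under `H₀` by `χs`. Then the `K`-span of `f₁` is isomorphic to
the principal series of `χs`. -/
theorem exists_equiv_of_profile (P : Pattern C) (χs : S.GG → 𝔽) (f₁ : ↥(IndSub C 𝔽 W σ))
    (a : S.GG) (w : W) (hw : w ≠ 0) (φ : S.GG → 𝔽)
    (hφ : ∀ x ∈ C.K, (f₁ : S.GG → W) (a * x) = φ x • w)
    (hsupp : ∀ g, (f₁ : S.GG → W) g ≠ 0 → ∃ k ∈ C.K, ∃ x ∈ C.K, g = k * (a * x))
    (hH : ∀ h ∈ C.H0, ∀ x ∈ C.K, φ (h * x) = χs h * φ x)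
    (hI : ∀ b ∈ C.I1, ∀ x ∈ C.K, φ (b * x) = φ x)
    (hJ : ∀ z ∈ C.I1, ∀ x ∈ C.K, φ (x * z) = φ x)
    (h1 : φ 1 = 1) (h0 : ∀ x ∈ C.K, x ∉ C.IK → φ x = 0) :
    ∃ e : ↥(orbitSpanOn 𝔽 (indRep C 𝔽 W σ) ↑C.K f₁) ≃ₗ[𝔽] ↥(PSchiSub C 𝔽 χs),
      ∀ (k : ↥C.K) (x x' : ↥(orbitSpanOn 𝔽 (indRep C 𝔽 W σ) ↑C.K f₁)),
        (↑x' : ↥(IndSub C 𝔽 W σ)) = indRep C 𝔽 W σ ↑k ↑x →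
        ((e x' : ↥(PSchiSub C 𝔽 χs)) : ↥C.K → 𝔽) =
          PSact C 𝔽 k ((e x : ↥(PSchiSub C 𝔽 χs)) : ↥C.K → 𝔽) := by
  obtain ⟨ℓ, hℓ⟩ := Module.Projective.exists_dual_ne_zero 𝔽 hw
  set lam : W →ₗ[𝔽] 𝔽 := (ℓ w)⁻¹ • ℓ with hlam
  have hlw : lam w = 1 := by simp [hlam, hℓ]
  let L : ↥(IndSub C 𝔽 W σ) →ₗ[𝔽] (↥C.K → 𝔽) :=
    { toFun := fun F x => lam ((F : S.GG → W) (a * x))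
      map_add' := fun F G => funext fun x => by simp
      map_smul' := fun c F => funext fun x => by simp }
  have hLapp : ∀ F x, L F x = lam ((F : S.GG → W) (a * x)) := fun _ _ => rfl
  have hLact : ∀ (k : C.K) F, L (indRep C 𝔽 W σ k F) = PSact C 𝔽 k (L F) := fun k F => by
    funext x
    change lam ((F : S.GG → W) (a * x * k)) = lam ((F : S.GG → W) (a * (x * k : C.K)))
    rw [Subgroup.coe_mul, mul_assoc]
  have hL1 : ∀ x : C.K, L f₁ x = φ x := fun x => by
    rw [hLapp, hφ x x.2, map_smul, hlw, smul_eq_mul, mul_one]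
  have hLk : ∀ (k x : C.K), L (indRep C 𝔽 W σ k f₁) x = φ (x * k) := fun k x => by
    rw [hLact]
    exact hL1 (x * k)
  set M := orbitSpanOn 𝔽 (indRep C 𝔽 W σ) ↑C.K f₁ with hM
  have hmem : ∀ F ∈ M, L F ∈ PSchiSub C 𝔽 χs := by
    intro F hF
    refine Submodule.span_induction ?_ ?_ ?_ ?_ hF
    · rintro _ ⟨k, hk, rfl⟩
      refine ⟨fun b hb x => ?_, fun h hh x => ?_, fun z hz x => ?_⟩
      · rw [hLk ⟨k, hk⟩, hLk ⟨k, hk⟩, Subgroup.coe_mul, mul_assoc]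
        exact hI b hb _ (C.K.mul_mem x.2 hk)
      · rw [hLk ⟨k, hk⟩, hLk ⟨k, hk⟩, Subgroup.coe_mul, mul_assoc]
        exact hH h hh _ (C.K.mul_mem x.2 hk)
      · rw [hLk ⟨k, hk⟩, hLk ⟨k, hk⟩, Subgroup.coe_mul]
        rw [← hJ _ (P.conj_Kone_mem_I1 hz hk) _ (C.K.mul_mem x.2 hk)]
        congr 1
        group
    · rw [map_zero]
      exact Submodule.zero_mem _
    · intro F G _ _ hF hG
      rw [map_add]
      exact Submodule.add_mem _ hF hG
    · intro c F _ hF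
      rw [map_smul]
      exact Submodule.smul_mem _ c hF
  have hline : ∀ F ∈ M, ∀ x : C.K, (F : S.GG → W) (a * x) = L F x • w := by
    intro F hF
    refine Submodule.span_induction ?_ ?_ ?_ ?_ hF
    · rintro _ ⟨k, hk, rfl⟩ x
      rw [hLk ⟨k, hk⟩]
      change (f₁ : S.GG → W) (a * x * k) = _
      rw [mul_assoc, hφ _ (C.K.mul_mem x.2 hk)]
    · intro x
      simp
    · intro F G _ _ hF hG x
      rw [map_add, Pi.add_apply, add_smul, ← hF, ← hG]
      rfl
    · intro c F _ hF x
      rw [map_smul, Pi.smul_apply, smul_assoc, ← hF]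
      rfl
  have hsuppM : ∀ F ∈ M, ∀ g, (F : S.GG → W) g ≠ 0 →
      ∃ k ∈ C.K, ∃ x ∈ C.K, g = k * (a * x) := by
    intro F hF
    refine Submodule.span_induction ?_ ?_ ?_ ?_ hF
    · rintro _ ⟨k, hk, rfl⟩ g hg
      obtain ⟨k', hk', x, hx, h⟩ := hsupp (g * k) hg
      refine ⟨k', hk', x * k⁻¹, C.K.mul_mem hx (C.K.inv_mem hk), ?_⟩
      rw [eq_mul_inv_of_mul_eq h]
      group
    · intro g hg
      exact absurd rfl hg
    · intro F G _ _ hF hG g hg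
      by_cases h : (F : S.GG → W) g = 0
      · refine hG g fun h' => hg ?_
        rw [Submodule.coe_add, Pi.add_apply, h, h', add_zero]
      · exact hF g h
    · intro c F _ hF g hg
      refine hF g fun h => hg ?_
      rw [Submodule.coe_smul, Pi.smul_apply, h, smul_zero]
  have hker : ∀ F ∈ M, L F = 0 → F = 0 := by
    intro F hF h
    refine Subtype.ext (funext fun g => ?_)
    by_contra hg
    obtain ⟨k, hk, x, hx, rfl⟩ := hsuppM F hF g hg
    apply hg
    rw [indSub_apply_mul F hk, hline F hF ⟨x, hx⟩, h]
    simp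
  have hleft : ∀ f ∈ PSchiSub C 𝔽 χs, ∀ y x : C.K, (y : S.GG) ∈ C.IK → f (y * x) = φ y * f x := by
    rintro f ⟨hf1, hf2, -⟩ y x hy
    obtain ⟨h, hh, hi⟩ := P.exists_H0_mul_I1 hy
    have hhK := P.mem_K_of_mem_IK hh.2
    have hiK := C.K.mul_mem (C.K.inv_mem hhK) y.2
    have hyy : y = ⟨h, hhK⟩ * ⟨h⁻¹ * y, hiK⟩ := Subtype.ext (by simp)
    have hφy : φ y = χs h := by
      have := hJ _ hi h hhK
      rw [mul_inv_cancel_left] at this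
      rw [this, ← mul_one h, hH h hh 1 C.K.one_mem, h1, mul_one, mul_one]
    rw [hφy]
    conv_lhs => rw [hyy, mul_assoc]
    rw [hf2 ⟨h, hhK⟩ hh, hf1 ⟨_, hiK⟩ hi]
  let eL : M →ₗ[𝔽] PSchiSub C 𝔽 χs :=
    (L.comp M.subtype).codRestrict _ fun F => hmem F F.2
  have heL : ∀ F : M, ((eL F : PSchiSub C 𝔽 χs) : C.K → 𝔽) = L F := fun _ => rfl
  have hbij : Function.Bijective eL := by
    refine ⟨fun F G h => Subtype.ext (sub_eq_zero.mp (hker _ (M.sub_mem F.2 G.2)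
      (by rw [map_sub, ← heL, ← heL, h, sub_self]))), fun f => ?_⟩
    have := P.finite_quotient
    have := Fintype.ofFinite (Quotient (QuotientGroup.rightRel P.iwahori))
    refine ⟨∑ c : Quotient (QuotientGroup.rightRel P.iwahori), (f : C.K → 𝔽) c.out •
      (⟨indRep C 𝔽 W σ ((c.out⁻¹ : C.K) : S.GG) f₁,
        Submodule.subset_span ⟨_, (c.out⁻¹ : C.K).2, rfl⟩⟩ : M), Subtype.ext (funext fun y => ?_)⟩
    rw [heL]
    simp only [Submodule.coe_sum, Submodule.coe_smul, map_sum, map_smul, Finset.sum_apply,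
      Pi.smul_apply, hLk, smul_eq_mul]
    rw [Finset.sum_eq_single (Quotient.mk _ y)]
    · set r := (Quotient.mk (QuotientGroup.rightRel P.iwahori) y).out with hr
      have hrel : y * r⁻¹ ∈ P.iwahori :=
        QuotientGroup.rightRel_apply.mp (Quotient.exact (Quotient.out_eq _))
      have := hleft f f.2 (y * r⁻¹) r hrel
      rw [inv_mul_cancel_right] at this
      rw [this, mul_comm]
      rfl
    · intro c _ hc
      rw [h0 _ (C.K.mul_mem y.2 (c.out⁻¹ : C.K).2), mul_zero]
      intro hmemI
      apply hc
      rw [← Quotient.out_eq c]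
      exact Quotient.sound (QuotientGroup.rightRel_apply.mpr hmemI)
    · intro h
      exact absurd (Finset.mem_univ _) h
  refine ⟨LinearEquiv.ofBijective eL hbij, fun k x x' h => ?_⟩
  rw [LinearEquiv.ofBijective_apply, LinearEquiv.ofBijective_apply, heL, heL, h, hLact]

end Translates

/-- The `K`-subrepresentation of `ind_K^G σ` generated by `f₁` is
isomorphic to the principal series `Ind_𝔹^{Γ_K} χ_σ^s`. -/
theorem stmt13
    (S : Setting) (C : Chamber S)
    (𝔽 : Type) [Field 𝔽] [IsAlgClosed 𝔽] [Algebra (ZMod S.p) 𝔽]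
    [Algebra.IsAlgebraic (ZMod S.p) 𝔽]
    (W : Type) [AddCommGroup W] [Module 𝔽 W]
    (σ : Representation 𝔽 ↥C.K W) (hσ : IsWeight C 𝔽 W σ)
    (v0 : W) (hv0 : v0 ≠ 0) (hv0inv : ∀ g ∈ C.I1, sigma' C 𝔽 W σ g v0 = v0)
    (χ : S.GG → 𝔽) (hχ : IsChi C 𝔽 W σ v0 χ)
    (ff : ℤ → ↥(IndSub C 𝔽 W σ)) (hff : IsFFamily C 𝔽 W σ v0 ff) :
    ∃ e : ↥(orbitSpanOn 𝔽 (indRep C 𝔽 W σ) ↑C.K (ff 1)) ≃ₗ[𝔽]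
          ↥(PSchiSub C 𝔽 (fun h => χ (C.βK * h * C.βK))),
      ∀ (k : ↥C.K) (x x' : ↥(orbitSpanOn 𝔽 (indRep C 𝔽 W σ) ↑C.K (ff 1))),
        (↑x' : ↥(IndSub C 𝔽 W σ)) = indRep C 𝔽 W σ ↑k ↑x →
        ((e x' : ↥(PSchiSub C 𝔽 (fun h => χ (C.βK * h * C.βK)))) : ↥C.K → 𝔽) =
          PSact C 𝔽 k ((e x : ↥(PSchiSub C 𝔽 (fun h => χ (C.βK * h * C.βK)))) : ↥C.K → 𝔽) := by
  obtain ⟨P⟩ := Pattern.nonempty_pattern C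
  obtain ⟨-, -, hinv, hsupp, hval, -⟩ := hff
  have hval1 := hval 1 one_pos
  have hsupp1 := hsupp 1
  have hinv1 : ∀ g ∈ C.I1, ∀ x, (ff 1 : S.GG → W) (x * g) = (ff 1 : S.GG → W) x :=
    fun g hg x => congrFun (congrArg Subtype.val (hinv 1 g hg)) x
  rw [zpow_neg_one] at hval1
  simp only [zpow_neg_one] at hsupp1
  have hβ := P.βK_mem
  set f₁ := ff 1
  set χs : S.GG → 𝔽 := fun h => χ (C.βK * h * C.βK) with hχs
  set w := sigma' C 𝔽 W σ C.βK v0 with hw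
  have hw0 : w ≠ 0 := sigma'_ne_zero hβ hv0
  have hwH : ∀ h ∈ C.H0, sigma' C 𝔽 W σ h w = χs h • w := fun h hh => by
    have hhK := P.mem_K_of_mem_IK hh.2
    have hb := P.βK_conj_mem_H0 hh
    have heq : h * C.βK = C.βK * (C.βK * h * C.βK) := by
      rw [← mul_assoc, ← mul_assoc, P.βK_sq, one_mul]
    rw [hw, ← Module.End.mul_apply, ← sigma'_mul hhK hβ, heq,
      sigma'_mul hβ (P.mem_K_of_mem_IK hb.2), Module.End.mul_apply, hχ _ hb, map_smul]
  have hH : ∀ h ∈ C.H0, ∀ x, (f₁ : S.GG → W) (S.alphaE⁻¹ * (h * x)) =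
      sigma' C 𝔽 W σ h ((f₁ : S.GG → W) (S.alphaE⁻¹ * x)) := fun h hh x => by
    rw [← mul_assoc, alpha_inv_mul_H0 hh, mul_assoc,
      indSub_apply_mul f₁ (P.mem_K_of_mem_IK hh.2)]
  have hIK : ∀ x ∈ C.K, (f₁ : S.GG → W) (S.alphaE⁻¹ * x) ≠ 0 → x ∈ C.IK := fun x hx h => by
    obtain ⟨k, hk, i, hi, hki⟩ := hsupp1 _ h
    have hiI := P.mem_IK_of_mem_I1 hi
    have hxk : x = S.alphaE * k * S.alphaE⁻¹ * i := by
      rw [mul_assoc, mul_assoc, ← mul_assoc k, ← hki, mul_inv_cancel_left]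
    have hxi : S.alphaE * k * S.alphaE⁻¹ ∈ C.K := by
      rw [← mul_inv_eq_of_eq_mul hxk]
      exact C.K.mul_mem hx (C.K.inv_mem (P.mem_K_of_mem_IK hiI))
    rw [hxk]
    exact P.mul_mem_IK (P.alpha_conj_mem_IK hk hxi) hiI
  have hex : ∀ x, ∃ c : 𝔽, x ∈ C.K → (f₁ : S.GG → W) (S.alphaE⁻¹ * x) = c • w := fun x => by
    by_cases hx : x ∈ C.IK
    · obtain ⟨h, hh, hi⟩ := P.exists_H0_mul_I1 hx
      refine ⟨χs h, fun _ => ?_⟩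
      have := hH h hh (h⁻¹ * x)
      rwa [mul_inv_cancel_left, hinv1 _ hi, ← mul_one S.alphaE⁻¹, mul_assoc, one_mul, mul_one,
        hval1, hwH h hh] at this
    · refine ⟨0, fun hxK => ?_⟩
      rw [zero_smul]
      by_contra h
      exact hx (hIK x hxK h)
  choose φ hφ using hex
  have hinj : ∀ c d : 𝔽, c • w = d • w → c = d := fun c d h => smul_left_injective 𝔽 hw0 h
  have hright : ∀ z ∈ C.I1, ∀ x ∈ C.K, φ (x * z) = φ x := fun z hz x hx => hinj _ _ <| by
    rw [← hφ x hx, ← hφ _ (C.K.mul_mem hx (P.mem_K_of_mem_IK (P.mem_IK_of_mem_I1 hz))),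
      ← mul_assoc, hinv1 z hz]
  have hzero : ∀ x ∈ C.K, x ∉ C.IK → φ x = 0 := fun x hx hxI => hinj _ _ <| by
    rw [← hφ x hx, zero_smul]
    by_contra h
    exact hxI (hIK x hx h)
  refine exists_equiv_of_profile P χs f₁ S.alphaE⁻¹ w hw0 φ hφ (fun g hg => ?_)
    (fun h hh x hx => hinj _ _ ?_) (fun b hb x hx => ?_) hright (hinj _ _ ?_) hzero
  · obtain ⟨k, hk, i, hi, rfl⟩ := hsupp1 g hg
    exact ⟨k, hk, i, P.mem_K_of_mem_IK (P.mem_IK_of_mem_I1 hi), mul_assoc _ _ _⟩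
  · rw [← hφ _ (C.K.mul_mem (P.mem_K_of_mem_IK hh.2) hx), hH h hh, hφ x hx, map_smul, hwH h hh,
      smul_smul, mul_comm]
  · have hbI := P.mem_IK_of_mem_I1 hb
    have hbK := P.mem_K_of_mem_IK hbI
    by_cases hxI : x ∈ C.IK
    · rw [← hright _ (P.conj_mem_I1 hb hxI) x hx]
      congr 1
      group
    · rw [hzero x hx hxI, hzero _ (C.K.mul_mem hbK hx)]
      intro h
      apply hxI
      simpa using P.mul_mem_IK (P.inv_mem_IK hbI) h
  · rw [← hφ 1 C.K.one_mem, mul_one, hval1, one_smul]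

end U21
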